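/- arXiv:2502.05468 — 3 statements merged into one kernel-verified Lean document; each statement's English description precedes it below -/
import Mathlib

section
/- Let E be a metric space, let p and q be Borel probability measures on E, let α ∈ (0,1], let L ≥ 0, and let f : E → ℝ be a bounded L-Lipschitz function. Suppose ε ≥ 0 is such that |∫ h dp − ∫ h dq| ≤ ε for every bounded 1-Lipschitz function h : E → ℝ. Then |CVaR_{p,α}(f) − CVaR_{q,α}(f)| ≤ (L/α)·ε. -/
open MeasureTheory

noncomputable def cvar {Ω : Type*} [MeasurableSpace Ω] (μ : Measure Ω) (α : ℝ)
    (Y : Ω → ℝ) : ℝ :=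
  ⨅ η : ℝ, (η + α⁻¹ * ∫ ω, max (Y ω - η) 0 ∂μ)

/-- The Rockafellar–Uryasev objective of a function bounded by `C` is bounded below by `-C`. -/
theorem neg_le_rockafellarUryasev {Ω : Type*} [MeasurableSpace Ω] (μ : Measure Ω)
    [IsProbabilityMeasure μ] {α : ℝ} (hα : α ∈ Set.Ioc (0 : ℝ) 1) {f : Ω → ℝ} {C : ℝ}
    (hC : ∀ x, |f x| ≤ C) (η : ℝ) (hint : Integrable (fun x => max (f x - η) 0) μ) :
    -C ≤ η + α⁻¹ * ∫ x, max (f x - η) 0 ∂μ := by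
  have h1 : max (-C - η) 0 ≤ ∫ x, max (f x - η) 0 ∂μ := by
    have h := integral_mono (μ := μ) (integrable_const (max (-C - η) 0)) hint fun x =>
      max_le_max (sub_le_sub_right (abs_le.mp (hC x)).1 η) le_rfl
    simpa using h
  have h0 : 0 ≤ ∫ x, max (f x - η) 0 ∂μ := (le_max_right _ _).trans h1
  have h2 := le_mul_of_one_le_left h0 ((one_le_inv₀ hα.1).mpr hα.2)
  linarith [le_max_left (-C - η) 0]

/-- If integrals of bounded `1`-Lipschitz functions against `p` and `q` differ by at most `ε`,
then integrals of bounded `L`-Lipschitz functions differ by at most `L * ε`. -/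
theorem abs_integral_sub_le_of_lipschitz {E : Type*} [MetricSpace E] [MeasurableSpace E]
    (p q : Measure E) [IsProbabilityMeasure p] [IsProbabilityMeasure q] {L ε : ℝ} (hL : 0 ≤ L)
    (hW : ∀ h : E → ℝ, (∃ C : ℝ, ∀ x, |h x| ≤ C) → LipschitzWith 1 h →
      |(∫ x, h x ∂p) - (∫ x, h x ∂q)| ≤ ε)
    {g : E → ℝ} (hgb : ∃ C : ℝ, ∀ x, |g x| ≤ C) (hg : LipschitzWith (Real.toNNReal L) g) :
    |(∫ x, g x ∂p) - (∫ x, g x ∂q)| ≤ L * ε := by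
  obtain ⟨C, hC⟩ := hgb
  have hdist : ∀ x y, |g x - g y| ≤ L * dist x y := fun x y => by
    simpa [Real.dist_eq, Real.coe_toNNReal L hL] using hg.dist_le_mul x y
  rcases hL.eq_or_lt with rfl | hL
  · obtain ⟨x₀⟩ := nonempty_of_isProbabilityMeasure p
    have hconst : g = fun _ => g x₀ := by
      funext x
      have h := hdist x x₀
      rw [zero_mul] at h
      exact sub_eq_zero.mp (abs_nonpos_iff.mp h)
    rw [hconst]
    simp
  · have h := hW (fun x => L⁻¹ * g x) ⟨L⁻¹ * C, fun x => ?_⟩ (LipschitzWith.of_dist_le_mul ?_)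
    · rw [integral_const_mul, integral_const_mul, ← mul_sub, abs_mul,
        abs_of_pos (inv_pos.mpr hL), inv_mul_le_iff₀ hL] at h
      exact h
    · rw [abs_mul, abs_of_pos (inv_pos.mpr hL)]
      exact mul_le_mul_of_nonneg_left (hC x) (inv_pos.mpr hL).le
    · intro x y
      rw [Real.dist_eq, ← mul_sub, abs_mul, abs_of_pos (inv_pos.mpr hL), inv_mul_le_iff₀ hL]
      simpa using hdist x y

theorem cvar_wasserstein_bound {E : Type*} [MetricSpace E] [MeasurableSpace E] [BorelSpace E]
    (p q : Measure E) [IsProbabilityMeasure p] [IsProbabilityMeasure q]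
    (α : ℝ) (hα : α ∈ Set.Ioc (0 : ℝ) 1)
    (L : ℝ) (hL : 0 ≤ L)
    (f : E → ℝ) (hfb : ∃ C : ℝ, ∀ x, |f x| ≤ C) (hfL : LipschitzWith (Real.toNNReal L) f)
    (ε : ℝ) (hε : 0 ≤ ε)
    (hW : ∀ h : E → ℝ, (∃ C : ℝ, ∀ x, |h x| ≤ C) → LipschitzWith 1 h →
      |(∫ x, h x ∂p) - (∫ x, h x ∂q)| ≤ ε) :
    |cvar p α f - cvar q α f| ≤ (L / α) * ε := by
  obtain ⟨C, hC⟩ := hfb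
  have hgL (η : ℝ) : LipschitzWith (Real.toNNReal L) fun x => max (f x - η) 0 := by
    have h : LipschitzWith (Real.toNNReal L) fun x => f x - η :=
      LipschitzWith.of_dist_le_mul fun x y => by simpa using hfL.dist_le_mul x y
    exact h.max_const 0
  have hgb (η : ℝ) (x : E) : |max (f x - η) 0| ≤ C + |η| := by
    have h1 := abs_le.mp (hC x)
    have h2 := neg_abs_le η
    have h3 := abs_nonneg η
    rw [abs_of_nonneg (le_max_right _ _)]
    exact max_le (by linarith) (by linarith)
  have hint (μ : Measure E) [IsProbabilityMeasure μ] (η : ℝ) :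
      Integrable (fun x => max (f x - η) 0) μ :=
    Integrable.of_bound (hgL η).continuous.measurable.aestronglyMeasurable (C + |η|)
      (ae_of_all _ (hgb η))
  have hbdd (μ : Measure E) [IsProbabilityMeasure μ] :
      BddBelow (Set.range fun η : ℝ => η + α⁻¹ * ∫ x, max (f x - η) 0 ∂μ) :=
    ⟨-C, Set.forall_mem_range.mpr fun η => neg_le_rockafellarUryasev μ hα hC η (hint μ η)⟩
  have hdiff (η : ℝ) : |α⁻¹ * (∫ x, max (f x - η) 0 ∂p) - α⁻¹ * ∫ x, max (f x - η) 0 ∂q|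
      ≤ L / α * ε := by
    rw [← mul_sub, abs_mul, abs_of_pos (inv_pos.mpr hα.1), div_eq_inv_mul, mul_assoc]
    exact mul_le_mul_of_nonneg_left
      (abs_integral_sub_le_of_lipschitz p q hL hW ⟨_, hgb η⟩ (hgL η)) (inv_pos.mpr hα.1).le
  have hpq : cvar p α f - L / α * ε ≤ cvar q α f := le_ciInf fun η => by
    have h : cvar p α f ≤ _ := ciInf_le (hbdd p) η
    have h' := abs_le.mp (hdiff η)
    linarith
  have hqp : cvar q α f - L / α * ε ≤ cvar p α f := le_ciInf fun η => by
    have h : cvar q α f ≤ _ := ciInf_le (hbdd q) η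
    have h' := abs_le.mp (hdiff η)
    linarith
  exact abs_le.mpr ⟨by linarith, by linarith⟩
end

section
/- Let (Ω, 𝔉, μ) be a probability space and let Y : Ω → ℝ be essentially bounded (and measurable). Then CVaR_α(Y) tends to the essential supremum of Y as α tends to 0 from the right: lim_{α → 0⁺} ⨅_{η ∈ ℝ} (η + α⁻¹ · ∫ max(Y(ω) − η, 0) dμ(ω)) = essSup Y. -/
open MeasureTheory

/-- If `Y` exceeds `m` with probability at least `α`, then `m` is a lower bound of the
Rockafellar–Uryasev objective at level `α`. -/
theorem le_add_inv_mul_integral_max {Ω : Type*} [MeasurableSpace Ω] {μ : Measure Ω}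
    [IsFiniteMeasure μ] {Y : Ω → ℝ} (hY : Integrable Y μ) {α m : ℝ} (hα : 0 < α)
    (hm : α ≤ μ.real {ω | m ≤ Y ω}) (η : ℝ) :
    m ≤ η + α⁻¹ * ∫ ω, max (Y ω - η) 0 ∂μ := by
  have hint : Integrable (fun ω => max (Y ω - η) 0) μ :=
    (hY.sub (integrable_const η)).pos_part
  have hnonneg : 0 ≤ ∫ ω, max (Y ω - η) 0 ∂μ := integral_nonneg fun ω => le_max_right _ _
  rcases le_or_gt m η with h | h
  · exact h.trans (le_add_of_nonneg_right (by positivity))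
  · have markov := mul_meas_ge_le_integral_of_nonneg
      (Filter.Eventually.of_forall fun ω => le_max_right (Y ω - η) 0) hint (m - η)
    have hsub : μ.real {ω | m ≤ Y ω} ≤ μ.real {ω | m - η ≤ max (Y ω - η) 0} :=
      measureReal_mono fun ω hω => le_max_of_le_left (sub_le_sub_right hω η)
    have hle : (m - η) * α ≤ ∫ ω, max (Y ω - η) 0 ∂μ :=
      (mul_le_mul_of_nonneg_left (hm.trans hsub) (sub_nonneg.2 h.le)).trans markov
    have hdiv : m - η ≤ α⁻¹ * ∫ ω, max (Y ω - η) 0 ∂μ := by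
      rw [inv_mul_eq_div]
      exact (le_div_iff₀ hα).2 hle
    linarith

theorem cvar_tendsto_essSup {Ω : Type*} [MeasurableSpace Ω] (μ : Measure Ω)
    [IsProbabilityMeasure μ] (Y : Ω → ℝ) (hY : Measurable Y)
    (hbdd : ∃ C : ℝ, ∀ᵐ ω ∂μ, |Y ω| ≤ C) :
    Filter.Tendsto (fun α : ℝ => cvar μ α Y) (nhdsWithin 0 (Set.Ioi 0))
      (nhds (essSup Y μ)) := by
  obtain ⟨C, hC⟩ := hbdd
  have hint : Integrable Y μ := Integrable.of_bound hY.aestronglyMeasurable C hC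
  have hle : ∀ᵐ ω ∂μ, Y ω ≤ essSup Y μ :=
    ae_le_essSup ⟨C, Filter.eventually_map.2 (hC.mono fun ω h => (abs_le.1 h).2)⟩
  have hcob : Filter.IsCoboundedUnder (· ≤ ·) (ae μ) Y :=
    Filter.IsBoundedUnder.isCoboundedUnder_le
      ⟨-C, Filter.eventually_map.2 (hC.mono fun ω h => (abs_le.1 h).1)⟩
  have hpos : ∀ m < essSup Y μ, 0 < μ.real {ω | m ≤ Y ω} := by
    intro m hm
    refine measureReal_nonneg.lt_of_ne' fun h0 => hm.not_ge ?_
    refine essSup_le_of_ae_le m ?_ hcob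
    have hnull : ∀ᵐ ω ∂μ, ¬ m ≤ Y ω := measure_eq_zero_iff_ae_notMem.1
      ((measureReal_eq_zero_iff).1 h0)
    exact hnull.mono fun ω h => (not_le.1 h).le
  have hlower : ∀ m < essSup Y μ, ∀ᶠ α in nhdsWithin (0 : ℝ) (Set.Ioi 0),
      ∀ η, m ≤ η + α⁻¹ * ∫ ω, max (Y ω - η) 0 ∂μ := by
    intro m hm
    filter_upwards [Ioc_mem_nhdsGT (hpos m hm)] with α hα
    exact le_add_inv_mul_integral_max hint hα.1 hα.2
  have hzero : ∫ ω, max (Y ω - essSup Y μ) 0 ∂μ = 0 :=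
    integral_eq_zero_of_ae (hle.mono fun ω h => max_eq_right (sub_nonpos.2 h))
  rw [tendsto_order]
  constructor
  · intro a ha
    obtain ⟨m, ham, hm⟩ := exists_between ha
    filter_upwards [hlower m hm] with α hα
    exact ham.trans_le (le_ciInf hα)
  · intro b hb
    filter_upwards [hlower (essSup Y μ - 1) (sub_one_lt _)] with α hα
    refine lt_of_le_of_lt (ciInf_le ⟨_, Set.forall_mem_range.2 hα⟩ (essSup Y μ)) ?_
    simpa [hzero] using hb
end

section
/- Let E be a real inner product space, let s ⊆ E be a convex set, let m > 0, let T ≥ 0, and let f, g : E → ℝ both be m-strongly convex on s. Suppose x_f ∈ s minimizes f over s, x_g ∈ s minimizes g over s, and |f(z) − g(z)| ≤ T for every z ∈ s. Then ‖x_f − x_g‖ ≤ 2·√(T/m). -/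
/-- Quadratic growth of a strongly convex function away from a minimizer, with the constant given
by convexity at the midpoint. -/
theorem StrongConvexOn.mul_norm_sub_sq_le_of_isMinOn {E : Type*} [NormedAddCommGroup E]
    [NormedSpace ℝ E] {s : Set E} {m : ℝ} {f : E → ℝ} {x y : E} (hf : StrongConvexOn s m f)
    (hx : x ∈ s) (hy : y ∈ s) (hmin : IsMinOn f s x) :
    m / 4 * ‖x - y‖ ^ 2 ≤ f y - f x := by
  have ha : (0 : ℝ) ≤ 1 / 2 := by norm_num
  have hab : (1 / 2 : ℝ) + 1 / 2 = 1 := by norm_num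
  have hconv := hf.2 hx hy ha ha hab
  have hle := isMinOn_iff.1 hmin _ (hf.1 hx hy ha ha hab)
  simp only [smul_eq_mul] at hconv
  linarith

theorem strongConvexOn_minimizer_stability {E : Type*} [NormedAddCommGroup E]
    [InnerProductSpace ℝ E] {s : Set E} {m : ℝ} (hm : 0 < m)
    {T : ℝ} (hT : 0 ≤ T) {f g : E → ℝ}
    (hf : StrongConvexOn s m f) (hg : StrongConvexOn s m g)
    {xf xg : E} (hxf : xf ∈ s) (hxg : xg ∈ s)
    (hxf_min : ∀ z ∈ s, f xf ≤ f z) (hxg_min : ∀ z ∈ s, g xg ≤ g z)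
    (hgap : ∀ z ∈ s, |f z - g z| ≤ T) :
    ‖xf - xg‖ ≤ 2 * Real.sqrt (T / m) := by
  have hf_growth := hf.mul_norm_sub_sq_le_of_isMinOn hxf hxg (isMinOn_iff.2 hxf_min)
  have hg_growth := hg.mul_norm_sub_sq_le_of_isMinOn hxg hxf (isMinOn_iff.2 hxg_min)
  rw [norm_sub_rev xg xf] at hg_growth
  have hgap_f := (abs_le.1 (hgap xf hxf)).1
  have hgap_g := (abs_le.1 (hgap xg hxg)).2
  have hsq : (‖xf - xg‖ / 2) ^ 2 ≤ T / m := by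
    rw [le_div_iff₀ hm]
    linarith
  linarith [Real.le_sqrt_of_sq_le hsq]
end
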